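/- (Completeness of fine-tuned certification.) Let F be any function on ℝ^{nm}, R and μ probability distributions on the n×m pixel grid, δ^μ a flow with Δ(R, δ^μ) = μ, and suppose the nearest adversarial example to μ has Wasserstein distance ε > 0, i.e., ε = min { W₁(μ, ν) : ν a probability distribution with F(ν) ≠ F(μ) }. Then (a) every feasible flow δ (i.e., Δ(R,δ) a probability distribution) with ‖δ − δ^μ‖₁ < ε satisfies F(Δ(R,δ)) = F(μ), and (b) there exists a feasible flow δ with ‖δ − δ^μ‖₁ = ε and F(Δ(R,δ)) ≠ F(μ). -/

import Mathlib

namespace WassersteinFlow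

/-- A flow on the `n × m` grid: a pair `(δ→, δ↓)` with `δ→ ∈ ℝ^{n×(m-1)}`
and `δ↓ ∈ ℝ^{(n-1)×m}`. -/
abbrev Flow (n m : ℕ) := (Fin n → Fin (m - 1) → ℝ) × (Fin (n - 1) → Fin m → ℝ)

/-- Entry access with out-of-range indices giving `0` (0-based indices). -/
def entry {a b : ℕ} (δ : Fin a → Fin b → ℝ) (i j : ℤ) : ℝ :=
  if h : 0 ≤ i ∧ i < (a : ℤ) ∧ 0 ≤ j ∧ j < (b : ℤ) then
    δ ⟨i.toNat, by omega⟩ ⟨j.toNat, by omega⟩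
  else 0

/-- The flow application map `Δ`:
`Δ(μ,δ)_{i,j} = μ_{i,j} + δ↓_{i−1,j} + δ→_{i,j−1} − δ↓_{i,j} − δ→_{i,j}`,
with out-of-range entries taken to be `0`. -/
def applyFlow {n m : ℕ} (μ : Fin n × Fin m → ℝ) (δ : Flow n m) : Fin n × Fin m → ℝ :=
  fun x =>
    μ x + entry δ.2 ((x.1 : ℤ) - 1) (x.2 : ℤ) + entry δ.1 (x.1 : ℤ) ((x.2 : ℤ) - 1)
      - entry δ.2 (x.1 : ℤ) (x.2 : ℤ) - entry δ.1 (x.1 : ℤ) (x.2 : ℤ)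

/-- The `L¹`-norm of a flow: the sum of absolute values of all entries. -/
def flowL1 {n m : ℕ} (δ : Flow n m) : ℝ :=
  (∑ i, ∑ j, |δ.1 i j|) + (∑ i, ∑ j, |δ.2 i j|)

/-- A probability distribution on the grid. -/
def IsProbDist {n m : ℕ} (μ : Fin n × Fin m → ℝ) : Prop :=
  (∀ x, 0 ≤ μ x) ∧ ∑ x, μ x = 1

/-- The `L¹` ground metric `d((i,j),(k,l)) = |i−k| + |j−l|` on the grid. -/
def gd {n m : ℕ} (x y : Fin n × Fin m) : ℝ :=
  ((|(x.1 : ℤ) - (y.1 : ℤ)| + |(x.2 : ℤ) - (y.2 : ℤ)| : ℤ) : ℝ)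

/-- `π` is a coupling of `μ` and `ν`. -/
def IsCoupling {n m : ℕ} (μ ν : Fin n × Fin m → ℝ)
    (π : (Fin n × Fin m) × (Fin n × Fin m) → ℝ) : Prop :=
  (∀ p, 0 ≤ π p) ∧ (∀ x, ∑ y, π (x, y) = μ x) ∧ (∀ y, ∑ x, π (x, y) = ν y)

/-- The 1-Wasserstein distance with `L¹` ground metric. -/
noncomputable def W1 {n m : ℕ} (μ ν : Fin n × Fin m → ℝ) : ℝ :=
  sInf {c | ∃ π, IsCoupling μ ν π ∧
    c = ∑ p : (Fin n × Fin m) × (Fin n × Fin m), gd p.1 p.2 * π p}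

/-- Index type for flattened flows. -/
abbrev FlowIdx (n m : ℕ) := (Fin n × Fin (m - 1)) ⊕ (Fin (n - 1) × Fin m)

/-- Flatten a flow to a vector in `ℝ^{n(m−1)+(n−1)m}`. -/
def flat {n m : ℕ} (δ : Flow n m) : FlowIdx n m → ℝ :=
  Sum.elim (fun p => δ.1 p.1 p.2) (fun p => δ.2 p.1 p.2)

/-- The tail of the grid edge carrying a flow entry. -/
def edgeSrc {n m : ℕ} : FlowIdx n m → Fin n × Fin m
  | Sum.inl p => (p.1, ⟨p.2, by omega⟩)
  | Sum.inr p => (⟨p.1, by omega⟩, p.2)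

/-- The head of the grid edge carrying a flow entry. -/
def edgeTgt {n m : ℕ} : FlowIdx n m → Fin n × Fin m
  | Sum.inl p => (p.1, ⟨p.2 + 1, by omega⟩)
  | Sum.inr p => (⟨p.1 + 1, by omega⟩, p.2)

/-- The flow with prescribed edge values. -/
def unflat {n m : ℕ} (a : FlowIdx n m → ℝ) : Flow n m :=
  (fun i j => a (Sum.inl (i, j)), fun i j => a (Sum.inr (i, j)))

/-- Net inflow at `x` of the edge values `a`. -/
def netInflow {n m : ℕ} (a : FlowIdx n m → ℝ) (x : Fin n × Fin m) : ℝ :=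
  ∑ e, a e * ((if edgeTgt e = x then 1 else 0) - (if edgeSrc e = x then 1 else 0))

theorem flat_unflat {n m : ℕ} (a : FlowIdx n m → ℝ) : flat (unflat a) = a := by
  funext e
  rcases e with e | e <;> rfl

theorem flowL1_eq_sum_flat {n m : ℕ} (δ : Flow n m) : flowL1 δ = ∑ e, |flat δ e| := by
  simp [flowL1, flat, Fintype.sum_sum_type, Fintype.sum_prod_type]

theorem sum_ite_eq_entry {a b : ℕ} (δ : Fin a → Fin b → ℝ) (i j : ℤ) :
    ∑ p : Fin a × Fin b, (if (p.1 : ℤ) = i ∧ (p.2 : ℤ) = j then δ p.1 p.2 else 0) =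
      entry δ i j := by
  unfold entry
  split_ifs with h
  · rw [Finset.sum_eq_single (⟨i.toNat, by omega⟩, ⟨j.toNat, by omega⟩)]
    · rw [if_pos]
      constructor <;> simp <;> omega
    · rintro ⟨⟨u, hu⟩, ⟨v, hv⟩⟩ - hne
      rw [if_neg]
      rintro ⟨h1, h2⟩
      apply hne
      simp only [Prod.mk.injEq, Fin.mk.injEq]
      simp only at h1 h2
      omega
    · simp
  · apply Finset.sum_eq_zero
    rintro ⟨⟨u, hu⟩, ⟨v, hv⟩⟩ -
    rw [if_neg]
    simp only
    omega

theorem applyFlow_eq_add_netInflow {n m : ℕ} (μ : Fin n × Fin m → ℝ) (δ : Flow n m)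
    (x : Fin n × Fin m) : applyFlow μ δ x = μ x + netInflow (flat δ) x := by
  obtain ⟨⟨i, hi⟩, ⟨j, hj⟩⟩ := x
  simp only [applyFlow, netInflow, ← sum_ite_eq_entry, Fintype.sum_sum_type, mul_sub,
    Finset.sum_sub_distrib, mul_ite, mul_one, mul_zero, flat, Sum.elim_inl, Sum.elim_inr,
    edgeSrc, edgeTgt, Prod.mk.injEq, Fin.ext_iff]
  have h1 : ∀ u : ℕ, ((u : ℤ) = (i : ℤ) - 1) ↔ u + 1 = i := fun u => by omega
  have h2 : ∀ u : ℕ, ((u : ℤ) = (j : ℤ) - 1) ↔ u + 1 = j := fun u => by omega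
  simp only [h1, h2, Nat.cast_inj]
  ring

theorem netInflow_add {n m : ℕ} (a b : FlowIdx n m → ℝ) (x : Fin n × Fin m) :
    netInflow (a + b) x = netInflow a x + netInflow b x := by
  simp [netInflow, add_mul, Finset.sum_add_distrib]

theorem netInflow_neg {n m : ℕ} (a : FlowIdx n m → ℝ) (x : Fin n × Fin m) :
    netInflow (-a) x = - netInflow a x := by
  simp [netInflow]

theorem netInflow_single {n m : ℕ} (e : FlowIdx n m) (x : Fin n × Fin m) :
    netInflow (Pi.single e 1) x =
      (if edgeTgt e = x then 1 else 0) - (if edgeSrc e = x then 1 else 0) := by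
  unfold netInflow
  rw [Finset.sum_eq_single e]
  · simp
  · intro b _ hb
    simp [hb]
  · simp

theorem netInflow_sum_smul {n m : ℕ} {ι : Type*} [Fintype ι] (c : ι → ℝ)
    (P : ι → FlowIdx n m → ℝ) (x : Fin n × Fin m) :
    netInflow (fun e => ∑ p, c p * P p e) x = ∑ p, c p * netInflow (P p) x := by
  simp only [netInflow, Finset.sum_mul, Finset.mul_sum]
  rw [Finset.sum_comm]
  simp only [mul_assoc]

theorem applyFlow_sub {n m : ℕ} (R : Fin n × Fin m → ℝ) (δ δ' : Flow n m) :
    applyFlow (applyFlow R δ') (δ - δ') = applyFlow R δ := by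
  funext x
  simp only [applyFlow_eq_add_netInflow]
  have h : flat δ = flat δ' + flat (δ - δ') := by
    funext e
    rcases e with e | e <;> simp [flat]
  rw [h, netInflow_add]
  ring

theorem gd_nonneg {n m : ℕ} (x y : Fin n × Fin m) : 0 ≤ gd x y := by
  unfold gd
  exact_mod_cast add_nonneg (abs_nonneg _) (abs_nonneg _)

theorem gd_self {n m : ℕ} (x : Fin n × Fin m) : gd x x = 0 := by
  simp [gd]

theorem gd_comm {n m : ℕ} (x y : Fin n × Fin m) : gd x y = gd y x := by
  simp only [gd, abs_sub_comm]

theorem gd_triangle {n m : ℕ} (x y z : Fin n × Fin m) : gd x z ≤ gd x y + gd y z := by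
  rw [gd, gd, gd, ← Int.cast_add, Int.cast_le]
  linarith [abs_sub_le (x.1 : ℤ) y.1 z.1, abs_sub_le (x.2 : ℤ) y.2 z.2]

theorem gd_edge {n m : ℕ} (e : FlowIdx n m) : gd (edgeSrc e) (edgeTgt e) = 1 := by
  rcases e with e | e <;> simp [gd, edgeSrc, edgeTgt]

/-- A unit flow from `x` to `y` of total variation at most `k`. -/
def HasUnitFlow {n m : ℕ} (x y : Fin n × Fin m) (k : ℝ) : Prop :=
  ∃ a : FlowIdx n m → ℝ,
    (∀ z, netInflow a z = (if y = z then 1 else 0) - (if x = z then 1 else 0)) ∧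
      ∑ e, |a e| ≤ k

theorem hasUnitFlow_refl {n m : ℕ} (x : Fin n × Fin m) : HasUnitFlow x x 0 :=
  ⟨0, fun z => by simp [netInflow], by simp⟩

theorem hasUnitFlow_edge {n m : ℕ} (e : FlowIdx n m) :
    HasUnitFlow (edgeSrc e) (edgeTgt e) 1 := by
  refine ⟨Pi.single e 1, netInflow_single e, ?_⟩
  rw [Finset.sum_eq_single e]
  · simp
  · intro b _ hb
    simp [hb]
  · simp

theorem HasUnitFlow.symm {n m : ℕ} {x y : Fin n × Fin m} {k : ℝ}
    (h : HasUnitFlow x y k) : HasUnitFlow y x k := by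
  obtain ⟨a, ha, hk⟩ := h
  refine ⟨-a, fun z => ?_, by simpa using hk⟩
  rw [netInflow_neg, ha]
  ring

theorem HasUnitFlow.trans {n m : ℕ} {x y z : Fin n × Fin m} {k l : ℝ}
    (h : HasUnitFlow x y k) (h' : HasUnitFlow y z l) : HasUnitFlow x z (k + l) := by
  obtain ⟨a, ha, hk⟩ := h
  obtain ⟨b, hb, hl⟩ := h'
  refine ⟨a + b, fun w => ?_, ?_⟩
  · rw [netInflow_add, ha, hb]
    ring
  · calc ∑ e, |(a + b) e| ≤ ∑ e, (|a e| + |b e|) := Finset.sum_le_sum fun e _ => abs_add_le _ _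
      _ ≤ k + l := by
        rw [Finset.sum_add_distrib]
        exact add_le_add hk hl

theorem hasUnitFlow_of_col_add {n m : ℕ} (i : Fin n) (j d : ℕ) (hd : j + d < m) :
    HasUnitFlow (i, (⟨j, by omega⟩ : Fin m)) (i, ⟨j + d, hd⟩) d := by
  induction d with
  | zero => simpa using hasUnitFlow_refl _
  | succ d ih =>
    have h := (ih (by omega)).trans
      (hasUnitFlow_edge (n := n) (m := m) (Sum.inl (i, ⟨j + d, by omega⟩)))
    simpa [edgeTgt, add_assoc] using h

theorem hasUnitFlow_of_row_add {n m : ℕ} (i d : ℕ) (j : Fin m) (hd : i + d < n) :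
    HasUnitFlow ((⟨i, by omega⟩ : Fin n), j) (⟨i + d, hd⟩, j) d := by
  induction d with
  | zero => simpa using hasUnitFlow_refl _
  | succ d ih =>
    have h := (ih (by omega)).trans
      (hasUnitFlow_edge (n := n) (m := m) (Sum.inr (⟨i + d, by omega⟩, j)))
    simpa [edgeTgt, add_assoc] using h

theorem hasUnitFlow_col {n m : ℕ} (i : Fin n) (j l : Fin m) :
    HasUnitFlow (i, j) (i, l) (gd (i, j) (i, l)) := by
  wlog h : j ≤ l generalizing j l
  · rw [gd_comm]
    exact (this l j (le_of_not_ge h)).symm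
  obtain ⟨j, hj⟩ := j
  obtain ⟨l, hl⟩ := l
  obtain ⟨d, rfl⟩ := Nat.exists_eq_add_of_le (Fin.mk_le_mk.mp h)
  simpa [gd] using hasUnitFlow_of_col_add i j d hl

theorem hasUnitFlow_row {n m : ℕ} (i k : Fin n) (j : Fin m) :
    HasUnitFlow (i, j) (k, j) (gd (i, j) (k, j)) := by
  wlog h : i ≤ k generalizing i k
  · rw [gd_comm]
    exact (this k i (le_of_not_ge h)).symm
  obtain ⟨i, hi⟩ := i
  obtain ⟨k, hk⟩ := k
  obtain ⟨d, rfl⟩ := Nat.exists_eq_add_of_le (Fin.mk_le_mk.mp h)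
  simpa [gd] using hasUnitFlow_of_row_add i d j hk

theorem hasUnitFlow_gd {n m : ℕ} (x y : Fin n × Fin m) : HasUnitFlow x y (gd x y) := by
  have h := (hasUnitFlow_row x.1 y.1 x.2).trans (hasUnitFlow_col y.1 x.2 y.2)
  simpa [gd] using h

theorem exists_flow_of_isCoupling {n m : ℕ} {μ ν : Fin n × Fin m → ℝ}
    {π : (Fin n × Fin m) × (Fin n × Fin m) → ℝ} (hπ : IsCoupling μ ν π) :
    ∃ δ : Flow n m, applyFlow μ δ = ν ∧ flowL1 δ ≤ ∑ p, gd p.1 p.2 * π p := by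
  choose P hP hPL using fun p : (Fin n × Fin m) × (Fin n × Fin m) => hasUnitFlow_gd p.1 p.2
  refine ⟨unflat fun e => ∑ p, π p * P p e, ?_, ?_⟩
  · funext x
    rw [applyFlow_eq_add_netInflow, flat_unflat, netInflow_sum_smul]
    simp only [hP, mul_sub, Finset.sum_sub_distrib, mul_ite, mul_one, mul_zero]
    have h1 : ∑ p : (Fin n × Fin m) × (Fin n × Fin m), (if p.2 = x then π p else 0) = ν x := by
      rw [Fintype.sum_prod_type]
      simp [hπ.2.2]
    have h2 : ∑ p : (Fin n × Fin m) × (Fin n × Fin m), (if p.1 = x then π p else 0) = μ x := by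
      rw [Fintype.sum_prod_type_right]
      simp [hπ.2.1]
    rw [h1, h2]
    ring
  · rw [flowL1_eq_sum_flat, flat_unflat]
    calc ∑ e, |∑ p, π p * P p e| ≤ ∑ e, ∑ p, π p * |P p e| := by
          refine Finset.sum_le_sum fun e _ => (Finset.abs_sum_le_sum_abs _ _).trans_eq ?_
          simp only [abs_mul, abs_of_nonneg (hπ.1 _)]
      _ = ∑ p, π p * ∑ e, |P p e| := by
          rw [Finset.sum_comm]
          simp only [Finset.mul_sum]
      _ ≤ ∑ p, gd p.1 p.2 * π p := by
          refine Finset.sum_le_sum fun p _ => ?_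
          rw [mul_comm]
          exact mul_le_mul_of_nonneg_right (hPL p) (hπ.1 p)

theorem W1_le_of_isCoupling {n m : ℕ} {μ ν : Fin n × Fin m → ℝ}
    {π : (Fin n × Fin m) × (Fin n × Fin m) → ℝ} (hπ : IsCoupling μ ν π) :
    W1 μ ν ≤ ∑ p, gd p.1 p.2 * π p := by
  refine csInf_le ⟨0, ?_⟩ ⟨π, hπ, rfl⟩
  rintro _ ⟨ρ, hρ, rfl⟩
  exact Finset.sum_nonneg fun p _ => mul_nonneg (gd_nonneg _ _) (hρ.1 p)

theorem isCoupling_mul {n m : ℕ} {μ ν : Fin n × Fin m → ℝ} (hμ : IsProbDist μ)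
    (hν : IsProbDist ν) : IsCoupling μ ν fun p => μ p.1 * ν p.2 := by
  refine ⟨fun p => mul_nonneg (hμ.1 _) (hν.1 _), fun x => ?_, fun y => ?_⟩
  · simp only [← Finset.mul_sum, hν.2, mul_one]
  · simp only [← Finset.sum_mul, hμ.2, one_mul]

theorem isCompact_setOf_isCoupling {n m : ℕ} (μ ν : Fin n × Fin m → ℝ) :
    IsCompact {π | IsCoupling μ ν π} := by
  refine IsCompact.of_isClosed_subset
    (isCompact_Icc (a := (0 : (Fin n × Fin m) × (Fin n × Fin m) → ℝ)) (b := fun p => μ p.1)) ?_ ?_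
  · have : {π | IsCoupling μ ν π} =
        (⋂ p, {π : (Fin n × Fin m) × (Fin n × Fin m) → ℝ | 0 ≤ π p}) ∩
        ((⋂ x, {π | ∑ y, π (x, y) = μ x}) ∩ (⋂ y, {π | ∑ x, π (x, y) = ν y})) := by
      ext π
      simp [IsCoupling]
    rw [this]
    refine (isClosed_iInter fun p => isClosed_le (by fun_prop) (by fun_prop)).inter
      ((isClosed_iInter fun x => isClosed_eq (by fun_prop) (by fun_prop)).inter
        (isClosed_iInter fun y => isClosed_eq (by fun_prop) (by fun_prop)))
  · intro π hπ
    refine ⟨fun p => hπ.1 p, fun p => ?_⟩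
    refine le_of_le_of_eq ?_ (hπ.2.1 p.1)
    exact Finset.single_le_sum (f := fun y => π (p.1, y)) (fun y _ => hπ.1 _)
      (Finset.mem_univ p.2)

theorem exists_isCoupling_eq_W1 {n m : ℕ} {μ ν : Fin n × Fin m → ℝ} (hμ : IsProbDist μ)
    (hν : IsProbDist ν) : ∃ π, IsCoupling μ ν π ∧ W1 μ ν = ∑ p, gd p.1 p.2 * π p := by
  obtain ⟨π, hπ, hmin⟩ := (isCompact_setOf_isCoupling μ ν).exists_isMinOn
    ⟨_, isCoupling_mul hμ hν⟩ (f := fun π => ∑ p, gd p.1 p.2 * π p) (by fun_prop)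
  refine ⟨π, hπ, (W1_le_of_isCoupling hπ).antisymm ?_⟩
  refine le_csInf ⟨_, π, hπ, rfl⟩ ?_
  rintro _ ⟨ρ, hρ, rfl⟩
  exact hmin hρ

/-- A nonnegative plan moving `μ` to `ν` at cost at most `c`, where mass may pass through
intermediate points. -/
def IsTransshipment {n m : ℕ} (μ ν : Fin n × Fin m → ℝ) (c : ℝ)
    (π : (Fin n × Fin m) × (Fin n × Fin m) → ℝ) : Prop :=
  (∀ p, 0 ≤ π p) ∧ (∀ x, ∑ y, π (x, y) - ∑ y, π (y, x) = μ x - ν x) ∧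
    ∑ p, gd p.1 p.2 * π p ≤ c

theorem isTransshipment_of_flow {n m : ℕ} (μ : Fin n × Fin m → ℝ) (δ : Flow n m) :
    ∃ π, IsTransshipment μ (applyFlow μ δ) (flowL1 δ) π := by
  refine ⟨fun p => ∑ e, ((flat δ e)⁺ * (if (edgeSrc e, edgeTgt e) = p then 1 else 0) +
    (flat δ e)⁻ * (if (edgeTgt e, edgeSrc e) = p then 1 else 0)), ?_, ?_, ?_⟩
  · intro p
    refine Finset.sum_nonneg fun e _ => add_nonneg ?_ ?_ <;>
      refine mul_nonneg (by positivity) (by split_ifs <;> norm_num)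
  · intro x
    have h1 : ∀ u v : Fin n × Fin m,
        ∑ y, (if u = x ∧ v = y then (1 : ℝ) else 0) = if u = x then 1 else 0 := by
      intro u v
      by_cases h : u = x <;> simp [h]
    have h2 : ∀ u v : Fin n × Fin m,
        ∑ y, (if u = y ∧ v = x then (1 : ℝ) else 0) = if v = x then 1 else 0 := by
      intro u v
      by_cases h : v = x <;> simp [h]
    rw [applyFlow_eq_add_netInflow, sub_add_cancel_left, Finset.sum_comm,
      Finset.sum_comm (s := Finset.univ (α := Fin n × Fin m)), netInflow,
      ← Finset.sum_sub_distrib, ← Finset.sum_neg_distrib]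
    refine Finset.sum_congr rfl fun e _ => ?_
    simp only [Prod.mk.injEq, Finset.sum_add_distrib, ← Finset.mul_sum, h1, h2]
    conv_rhs => rw [← posPart_sub_negPart (flat δ e)]
    ring
  · rw [flowL1_eq_sum_flat]
    simp only [Finset.mul_sum]
    rw [Finset.sum_comm]
    refine Finset.sum_le_sum fun e _ => ?_
    simp only [mul_add, Finset.sum_add_distrib, mul_ite, mul_one, mul_zero,
      Finset.sum_ite_eq, Finset.mem_univ, if_true, gd_comm (edgeTgt e), gd_edge, one_mul,
      posPart_add_negPart]
    exact le_rfl

theorem IsTransshipment.reroute {n m : ℕ} {μ ν : Fin n × Fin m → ℝ} {c : ℝ}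
    {π : (Fin n × Fin m) × (Fin n × Fin m) → ℝ} (h : IsTransshipment μ ν c π)
    {x y z : Fin n × Fin m} {t : ℝ} (ht : 0 ≤ t) (hxy : t ≤ π (x, y)) (hyz : t ≤ π (y, z)) :
    IsTransshipment μ ν c (fun p => π p - t * (if (x, y) = p then 1 else 0)
      - t * (if (y, z) = p then 1 else 0) + t * (if (x, z) = p then 1 else 0)) := by
  refine ⟨fun p => ?_, fun w => ?_, ?_⟩
  · have h0 := h.1 p
    by_cases h1 : (x, y) = p
    · subst h1
      by_cases h2 : (y, z) = (x, y)
      · obtain ⟨rfl, rfl⟩ := Prod.mk.inj h2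
        simp only [if_true]
        linarith
      · simp only [if_true, if_neg h2]
        split_ifs <;> linarith
    · simp only [if_neg h1]
      by_cases h2 : (y, z) = p
      · subst h2
        simp only [if_true]
        split_ifs <;> linarith
      · simp only [if_neg h2]
        split_ifs <;> linarith
  · rw [← h.2.1 w]
    simp only [Prod.mk.injEq, Finset.sum_add_distrib, Finset.sum_sub_distrib, ← Finset.mul_sum]
    have h1 : ∀ u v : Fin n × Fin m,
        ∑ y, (if u = w ∧ v = y then (1 : ℝ) else 0) = if u = w then 1 else 0 := by
      intro u v
      by_cases h : u = w <;> simp [h]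
    have h2 : ∀ u v : Fin n × Fin m,
        ∑ y, (if u = y ∧ v = w then (1 : ℝ) else 0) = if v = w then 1 else 0 := by
      intro u v
      by_cases h : v = w <;> simp [h]
    simp only [h1, h2]
    ring
  · refine le_trans ?_ h.2.2
    simp only [mul_add, mul_sub, Finset.sum_add_distrib, Finset.sum_sub_distrib, mul_ite, mul_one,
      mul_zero, Finset.sum_ite_eq, Finset.mem_univ, if_true]
    nlinarith [mul_le_mul_of_nonneg_right (gd_triangle x y z) ht]

theorem IsTransshipment.exists_minimal {n m : ℕ} {μ ν : Fin n × Fin m → ℝ} {c : ℝ}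
    {π : (Fin n × Fin m) × (Fin n × Fin m) → ℝ} (h : IsTransshipment μ ν c π) :
    ∃ ρ, IsTransshipment μ ν c ρ ∧ ∀ σ, IsTransshipment μ ν c σ → ∑ p, ρ p ≤ ∑ p, σ p := by
  have hclosed : IsClosed {π | IsTransshipment μ ν c π} := by
    have : {π | IsTransshipment μ ν c π} =
        (⋂ p, {π : (Fin n × Fin m) × (Fin n × Fin m) → ℝ | 0 ≤ π p}) ∩
        ((⋂ x, {π | ∑ y, π (x, y) - ∑ y, π (y, x) = μ x - ν x}) ∩
          {π | ∑ p, gd p.1 p.2 * π p ≤ c}) := by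
      ext π
      simp [IsTransshipment]
    rw [this]
    exact (isClosed_iInter fun p => isClosed_le (by fun_prop) (by fun_prop)).inter
      ((isClosed_iInter fun x => isClosed_eq (by fun_prop) (by fun_prop)).inter
        (isClosed_le (by fun_prop) (by fun_prop)))
  have hcompact := (isCompact_Icc (a := (0 : (Fin n × Fin m) × (Fin n × Fin m) → ℝ))
    (b := fun _ => ∑ p, π p)).inter_right hclosed
  have hmem : ∀ σ, IsTransshipment μ ν c σ → ∑ p, σ p ≤ ∑ p, π p →
      σ ∈ Set.Icc (0 : (Fin n × Fin m) × (Fin n × Fin m) → ℝ) (fun _ => ∑ p, π p) ∩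
        {π | IsTransshipment μ ν c π} := fun σ hσ hle =>
    ⟨⟨fun p => hσ.1 p, fun p => (Finset.single_le_sum (fun q _ => hσ.1 q)
      (Finset.mem_univ p)).trans hle⟩, hσ⟩
  obtain ⟨ρ, hρ, hmin⟩ := hcompact.exists_isMinOn ⟨π, hmem π h le_rfl⟩
    (f := fun π => ∑ p, π p) (by fun_prop)
  refine ⟨ρ, hρ.2, fun σ hσ => ?_⟩
  rcases le_total (∑ p, σ p) (∑ p, π p) with hle | hle
  · exact hmin (hmem σ hσ hle)
  · exact (hmin (hmem π h le_rfl)).trans hle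

theorem IsTransshipment.W1_le {n m : ℕ} {μ ν : Fin n × Fin m → ℝ} (hμ : IsProbDist μ)
    (hν : IsProbDist ν) {c : ℝ} {π : (Fin n × Fin m) × (Fin n × Fin m) → ℝ}
    (h : IsTransshipment μ ν c π) : W1 μ ν ≤ c := by
  obtain ⟨ρ, hρ, hmin⟩ := h.exists_minimal
  have hno : ∀ x y z, ρ (x, y) = 0 ∨ ρ (y, z) = 0 := by
    intro x y z
    by_contra! hne
    have ht : 0 < min (ρ (x, y)) (ρ (y, z)) :=
      lt_min ((hρ.1 _).lt_of_ne' hne.1) ((hρ.1 _).lt_of_ne' hne.2)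
    have := hmin _ (hρ.reroute ht.le (min_le_left _ _) (min_le_right _ _))
    simp only [Finset.sum_add_distrib, Finset.sum_sub_distrib, mul_ite, mul_one,
      mul_zero, Finset.sum_ite_eq, Finset.mem_univ, if_true] at this
    linarith
  have hout : ∀ x, ∑ y, ρ (x, y) ≤ μ x := by
    intro x
    by_cases hz : ∀ y, ρ (x, y) = 0
    · simpa [hz] using hμ.1 x
    · push Not at hz
      obtain ⟨z, hz⟩ := hz
      have hin : ∑ y, ρ (y, x) = 0 :=
        Finset.sum_eq_zero fun y _ => (hno y x z).resolve_right hz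
      linarith [hρ.2.1 x, hν.1 x]
  have hc : IsCoupling μ ν fun p =>
      ρ p + if p.1 = p.2 then μ p.1 - ∑ y, ρ (p.1, y) else 0 := by
    refine ⟨fun p => add_nonneg (hρ.1 p) ?_, fun x => ?_, fun y => ?_⟩
    · split_ifs
      · exact sub_nonneg.mpr (hout _)
      · exact le_rfl
    · simp [Finset.sum_add_distrib]
    · simp only [Finset.sum_add_distrib, Finset.sum_ite_eq', Finset.mem_univ, if_true]
      linarith [hρ.2.1 y]
  refine (W1_le_of_isCoupling hc).trans (le_trans (le_of_eq ?_) hρ.2.2)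
  refine Finset.sum_congr rfl fun p _ => ?_
  split_ifs with hp
  · rw [hp, gd_self, zero_mul, zero_mul]
  · rw [add_zero]

theorem W1_applyFlow_le {n m : ℕ} {μ : Fin n × Fin m → ℝ} {δ : Flow n m} (hμ : IsProbDist μ)
    (hν : IsProbDist (applyFlow μ δ)) : W1 μ (applyFlow μ δ) ≤ flowL1 δ := by
  obtain ⟨π, hπ⟩ := isTransshipment_of_flow μ δ
  exact hπ.W1_le hμ hν

/-- Completeness of fine-tuned certification: if `ε = min { W₁(μ,ν) : F(ν) ≠ F(μ) } > 0`,
then (a) every feasible flow `δ` with `‖δ − δ^μ‖₁ < ε` satisfies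
`F(Δ(R,δ)) = F(μ)`, and (b) there is a feasible flow `δ` with `‖δ − δ^μ‖₁ = ε`
and `F(Δ(R,δ)) ≠ F(μ)`. -/
theorem completeness_of_fine_tuned_certification {α : Type*} (n m : ℕ)
    (F : (Fin n × Fin m → ℝ) → α)
    (R μ : Fin n × Fin m → ℝ) (hR : IsProbDist R) (hμ : IsProbDist μ)
    (δμ : Flow n m) (hδμ : applyFlow R δμ = μ)
    (ε : ℝ) (hεpos : 0 < ε)
    (hε : IsLeast {r | ∃ ν : Fin n × Fin m → ℝ,
      IsProbDist ν ∧ F ν ≠ F μ ∧ r = W1 μ ν} ε) :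
    (∀ δ : Flow n m, IsProbDist (applyFlow R δ) → flowL1 (δ - δμ) < ε →
      F (applyFlow R δ) = F μ) ∧
    (∃ δ : Flow n m, IsProbDist (applyFlow R δ) ∧ flowL1 (δ - δμ) = ε ∧
      F (applyFlow R δ) ≠ F μ) := by
  subst hδμ
  refine ⟨fun δ hδ hlt => ?_, ?_⟩
  · by_contra hne
    have hle : ε ≤ W1 (applyFlow R δμ) (applyFlow R δ) := hε.2 ⟨_, hδ, hne, rfl⟩
    rw [← applyFlow_sub R δ δμ] at hδ hle
    linarith [W1_applyFlow_le hμ hδ]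
  · obtain ⟨ν, hν, hne, hW⟩ := hε.1
    obtain ⟨π, hπ, hcost⟩ := exists_isCoupling_eq_W1 hμ hν
    obtain ⟨δ, rfl, hδ⟩ := exists_flow_of_isCoupling hπ
    have happ : applyFlow R (δ + δμ) = applyFlow (applyFlow R δμ) δ := by
      rw [← applyFlow_sub R (δ + δμ) δμ, add_sub_cancel_right]
    refine ⟨δ + δμ, happ ▸ hν, ?_, happ ▸ hne⟩
    rw [add_sub_cancel_right]
    linarith [W1_applyFlow_le hμ hν]

end WassersteinFlow
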